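/- Let A_1, …, A_k be real data matrices with n columns (A_i ∈ ℝ^{m_i×n}), let d ≤ n be a positive integer, and set s := ⌊√(2k + 1/4) − 3/2⌋. If s < d, then there exists P ∈ P_d such that min over 1 ≤ i ≤ k of ‖A_iP‖_F² is at least (1 − s/d) · OPT_d, where OPT_d := max over Q ∈ P_d of min over 1 ≤ i ≤ k of ‖A_iQ‖_F². -/

import Mathlib

open Matrix

/-- The symmetric real matrices `Y` with `0 ≤ Y ≤ 1` in the Loewner order and trace `t`. -/
def fantope (n : ℕ) (t : ℝ) : Set (Matrix (Fin n) (Fin n) ℝ) :=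
  {Y | Y.PosSemidef ∧ (1 - Y).PosSemidef ∧ Y.trace = t}

theorem Matrix.PosSemidef.abs_apply_le_half_add_diag {n : ℕ} {Y : Matrix (Fin n) (Fin n) ℝ}
    (hY : Y.PosSemidef) (i j : Fin n) : |Y i j| ≤ (Y i i + Y j j) / 2 := by
  have h₁ := hY.dotProduct_mulVec_nonneg (Pi.single i 1 + Pi.single j 1)
  have h₂ := hY.dotProduct_mulVec_nonneg (Pi.single i 1 - Pi.single j 1)
  have hs : Y j i = Y i j := by simpa using hY.1.apply i j
  simp only [star_trivial, mulVec_add, mulVec_sub, mulVec_single_one, add_dotProduct,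
    sub_dotProduct, dotProduct_add, dotProduct_sub, single_one_dotProduct, col_apply] at h₁ h₂
  rw [abs_le]
  constructor <;> linarith

theorem Matrix.isClosed_setOf_posSemidef (n : ℕ) :
    IsClosed {Y : Matrix (Fin n) (Fin n) ℝ | Y.PosSemidef} := by
  simp only [posSemidef_iff_dotProduct_mulVec, IsHermitian, Set.ofPred_and, Set.ofPred_forall]
  refine (isClosed_eq (by fun_prop) (by fun_prop)).inter (isClosed_iInter fun x ↦ ?_)
  exact isClosed_le continuous_const (by fun_prop)

theorem isCompact_fantope (n : ℕ) (t : ℝ) : IsCompact (fantope n t) := by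
  have hbox : IsCompact
      (Set.univ.pi fun _ ↦ Set.univ.pi fun _ ↦ Set.Icc (-1) 1 : Set (Fin n → Fin n → ℝ)) :=
    isCompact_univ_pi fun _ ↦ isCompact_univ_pi fun _ ↦ isCompact_Icc
  refine hbox.of_isClosed_subset (t := fantope n t) ?_ ?_
  · have h := isClosed_setOf_posSemidef n
    exact h.inter ((h.preimage (f := fun Y ↦ 1 - Y) (by fun_prop)).inter
      (isClosed_eq (f := Matrix.trace) (by fun_prop) continuous_const))
  · rintro Y ⟨h₀, h₁, -⟩ i - j -
    have h := h₀.abs_apply_le_half_add_diag i j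
    have hi : 0 ≤ 1 - Y i i := by simpa using h₁.diag_nonneg (i := i)
    have hj : 0 ≤ 1 - Y j j := by simpa using h₁.diag_nonneg (i := j)
    exact abs_le.1 (h.trans (by linarith))

/-- A symmetric diagonally dominant matrix is positive semidefinite. -/
theorem Matrix.posSemidef_diagonal_add_of_sum_abs_le {n : ℕ} {D : Matrix (Fin n) (Fin n) ℝ}
    (hD : D.IsSymm) {μ : Fin n → ℝ} (h : ∀ i, ∑ j, |D i j| ≤ μ i) :
    (diagonal μ + D).PosSemidef := by
  refine .of_dotProduct_mulVec_nonneg ?_ fun x ↦ ?_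
  · exact (isHermitian_diagonal μ).add (by rwa [IsHermitian, conjTranspose_eq_transpose_of_trivial])
  have hswap : ∑ i, ∑ j, |D i j| * (x j ^ 2 / 2) = ∑ i, ∑ j, |D i j| * (x i ^ 2 / 2) := by
    rw [Finset.sum_comm]
    simp only [fun i j ↦ hD.apply i j]
  have hentry : ∀ i j, -(|D i j| * (x i ^ 2 / 2) + |D i j| * (x j ^ 2 / 2)) ≤
      x i * (D i j * x j) := fun i j ↦ by
    have h₁ : |x i * (D i j * x j)| = |D i j| * (|x i| * |x j|) := by simp only [abs_mul]; ring
    have h₂ : |x i| * |x j| ≤ x i ^ 2 / 2 + x j ^ 2 / 2 := by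
      nlinarith [sq_nonneg (|x i| - |x j|), sq_abs (x i), sq_abs (x j)]
    have h₃ := mul_le_mul_of_nonneg_left h₂ (abs_nonneg (D i j))
    linarith [neg_abs_le (x i * (D i j * x j))]
  have hoff : -∑ i, (∑ j, |D i j|) * x i ^ 2 ≤ ∑ i, ∑ j, x i * (D i j * x j) := by
    refine le_trans (le_of_eq ?_)
      (Finset.sum_le_sum fun i _ ↦ Finset.sum_le_sum fun j _ ↦ hentry i j)
    simp only [Finset.sum_neg_distrib, Finset.sum_add_distrib, hswap]
    rw [← Finset.sum_add_distrib]
    simp only [← Finset.sum_mul, ← two_mul]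
    congr 1
    refine Finset.sum_congr rfl fun i _ ↦ by ring
  have hdiag : ∑ i, (∑ j, |D i j|) * x i ^ 2 ≤ ∑ i, μ i * x i ^ 2 :=
    Finset.sum_le_sum fun i _ ↦ mul_le_mul_of_nonneg_right (h i) (sq_nonneg _)
  have hval : star x ⬝ᵥ (diagonal μ + D) *ᵥ x =
      ∑ i, μ i * x i ^ 2 + ∑ i, ∑ j, x i * (D i j * x j) := by
    rw [add_mulVec, dotProduct_add]
    congr 1
    · simp only [dotProduct, mulVec_diagonal, star_trivial]
      exact Finset.sum_congr rfl fun i _ ↦ by ring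
    · simp [dotProduct, mulVec, Finset.mul_sum]
  rw [hval]
  linarith

/-- If `k < |S| (|S| + 1) / 2`, then `k` linear functionals have a common nonzero symmetric zero
supported on `S ×ˢ S`. -/
theorem Matrix.exists_isSymm_ne_zero_of_lt_choose {n k : ℕ} (S : Finset (Fin n))
    (hS : k < (S.card + 1).choose 2) (φ : Fin k → Matrix (Fin n) (Fin n) ℝ →ₗ[ℝ] ℝ) :
    ∃ D : Matrix (Fin n) (Fin n) ℝ, D ≠ 0 ∧ D.IsSymm ∧ (∀ i j, D i j ≠ 0 → i ∈ S ∧ j ∈ S) ∧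
      ∀ l, φ l D = 0 := by
  let E : (S.sym2 → ℝ) →ₗ[ℝ] Matrix (Fin n) (Fin n) ℝ :=
    { toFun g := .of fun i j ↦ if h : s(i, j) ∈ S.sym2 then g ⟨s(i, j), h⟩ else 0
      map_add' g g' := by
        ext i j
        simp only [Matrix.add_apply, of_apply]
        split_ifs <;> simp
      map_smul' c g := by
        ext i j
        simp only [Matrix.smul_apply, of_apply]
        split_ifs <;> simp }
  have hE : ∀ g i j, E g i j = if h : s(i, j) ∈ S.sym2 then g ⟨s(i, j), h⟩ else 0 :=
    fun _ _ _ ↦ rfl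
  have hker : LinearMap.ker (LinearMap.pi fun l ↦ φ l ∘ₗ E) ≠ ⊥ := by
    refine LinearMap.ker_ne_bot_of_finrank_lt ?_
    rwa [Module.finrank_fin_fun, Module.finrank_fintype_fun_eq_card, Fintype.card_coe,
      Finset.card_sym2]
  obtain ⟨g, hg, hg0⟩ := Submodule.exists_mem_ne_zero_of_ne_bot hker
  refine ⟨E g, fun h0 ↦ hg0 ?_, ?_, fun i j hij ↦ ?_, fun l ↦ congrFun hg l⟩
  · funext ⟨p, hp⟩
    induction p with
    | h i j => simpa [hE, hp] using congrFun (congrFun h0 i) j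
  · ext i j
    simp only [transpose_apply, hE, Sym2.eq_swap (a := j) (b := i)]
  · by_contra hc
    exact hij (by rw [hE, dif_neg (by simpa using hc)])

theorem exists_mem_fantope_isMax_iInf {n k : ℕ} (hk : 0 < k)
    (φ : Fin k → Matrix (Fin n) (Fin n) ℝ →ₗ[ℝ] ℝ) {t : ℝ} (hne : (fantope n t).Nonempty) :
    ∃ Y ∈ fantope n t, (∀ Z ∈ fantope n t, ⨅ i, φ i Z ≤ ⨅ i, φ i Y) ∧
      ∀ Z ∈ fantope n t, ⨅ i, φ i Y ≤ ⨅ i, φ i Z →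
        ∑ i, ∑ j, Z i j ^ 2 ≤ ∑ i, ∑ j, Y i j ^ 2 := by
  have : Nonempty (Fin k) := ⟨⟨0, hk⟩⟩
  have hf : Continuous fun Y ↦ ⨅ i, φ i Y := by
    simp only [← Finset.inf'_univ_eq_ciInf]
    exact Continuous.finset_inf'_apply _ fun i _ ↦ (φ i).continuous_of_finiteDimensional
  obtain ⟨Y₀, hY₀, hmax⟩ := (isCompact_fantope n t).exists_isMaxOn hne hf.continuousOn
  have hF : IsCompact (fantope n t ∩ {Y | ⨅ i, φ i Y₀ ≤ ⨅ i, φ i Y}) :=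
    (isCompact_fantope n t).inter_right (isClosed_le continuous_const hf)
  have hg : Continuous fun Y : Matrix (Fin n) (Fin n) ℝ ↦ ∑ i, ∑ j, Y i j ^ 2 := by fun_prop
  obtain ⟨Y, hY, hYmax⟩ := hF.exists_isMaxOn ⟨Y₀, hY₀, le_refl (⨅ i, φ i Y₀)⟩ hg.continuousOn
  exact ⟨Y, hY.1, fun Z hZ ↦ (hmax hZ).trans hY.2, fun Z hZ hle ↦ hYmax ⟨hZ, hY.2.trans hle⟩⟩

theorem eq_zero_of_isMax_iInf {n k : ℕ} (hk : 0 < k)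
    {φ : Fin k → Matrix (Fin n) (Fin n) ℝ →ₗ[ℝ] ℝ} {t : ℝ} {Y Δ : Matrix (Fin n) (Fin n) ℝ}
    (hmax : ∀ Z ∈ fantope n t, ⨅ i, φ i Z ≤ ⨅ i, φ i Y)
    (hsq : ∀ Z ∈ fantope n t, ⨅ i, φ i Y ≤ ⨅ i, φ i Z →
      ∑ i, ∑ j, Z i j ^ 2 ≤ ∑ i, ∑ j, Y i j ^ 2)
    (hadd : Y + Δ ∈ fantope n t) (hsub : Y - Δ ∈ fantope n t) {c : ℝ} (hc : ∀ i, φ i Δ = c) :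
    Δ = 0 := by
  have : Nonempty (Fin k) := ⟨⟨0, hk⟩⟩
  have hbdd : BddBelow (Set.range fun i ↦ φ i Y) := Set.finite_range _ |>.bddBelow
  have h₁ : (⨅ i, φ i Y) + c ≤ ⨅ i, φ i (Y + Δ) := le_ciInf fun i ↦ by
    rw [map_add, hc]
    linarith [ciInf_le hbdd i]
  have h₂ : (⨅ i, φ i Y) - c ≤ ⨅ i, φ i (Y - Δ) := le_ciInf fun i ↦ by
    rw [map_sub, hc]
    linarith [ciInf_le hbdd i]
  have h₃ := hmax _ hadd
  have h₄ := hmax _ hsub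
  have h₅ := hsq _ hadd (by linarith)
  have h₆ := hsq _ hsub (by linarith)
  have hpar : ∑ i, ∑ j, (Y + Δ) i j ^ 2 + ∑ i, ∑ j, (Y - Δ) i j ^ 2 =
      2 * ∑ i, ∑ j, Y i j ^ 2 + 2 * ∑ i, ∑ j, Δ i j ^ 2 := by
    simp only [Finset.mul_sum, ← Finset.sum_add_distrib, Matrix.add_apply, Matrix.sub_apply]
    exact Finset.sum_congr rfl fun i _ ↦ Finset.sum_congr rfl fun j _ ↦ by ring
  have h₀ : ∑ i, ∑ j, Δ i j ^ 2 = 0 :=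
    le_antisymm (by linarith) (Finset.sum_nonneg fun i _ ↦ Finset.sum_nonneg fun j _ ↦ sq_nonneg _)
  ext i j
  have hrow := (Finset.sum_eq_zero_iff_of_nonneg
    fun i _ ↦ Finset.sum_nonneg fun j _ ↦ sq_nonneg (Δ i j)).1 h₀ i (Finset.mem_univ i)
  have hij := (Finset.sum_eq_zero_iff_of_nonneg
    fun j _ ↦ sq_nonneg (Δ i j)).1 hrow j (Finset.mem_univ j)
  exact pow_eq_zero_iff two_ne_zero |>.1 hij

theorem exists_diagonalization_of_mem_fantope {n : ℕ} {t : ℝ} {Y : Matrix (Fin n) (Fin n) ℝ}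
    (hY : Y ∈ fantope n t) :
    ∃ (U : Matrix (Fin n) (Fin n) ℝ) (μ : Fin n → ℝ), Uᵀ * U = 1 ∧ Y = U * diagonal μ * Uᵀ ∧
      (∀ j, 0 ≤ μ j) ∧ (∀ j, μ j ≤ 1) ∧ ∑ j, μ j = t := by
  obtain ⟨h₀, h₁, htr⟩ := hY
  let U : Matrix (Fin n) (Fin n) ℝ := h₀.1.eigenvectorUnitary
  have hU : Uᵀ * U = 1 := by
    simpa [star_eq_conjTranspose, conjTranspose_eq_transpose_of_trivial] using
      Unitary.coe_star_mul_self h₀.1.eigenvectorUnitary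
  have hspec : Y = U * diagonal h₀.1.eigenvalues * Uᵀ := by
    simpa [Unitary.conjStarAlgAut_apply, star_eq_conjTranspose,
      conjTranspose_eq_transpose_of_trivial] using h₀.1.spectral_theorem
  refine ⟨U, h₀.1.eigenvalues, hU, hspec, h₀.eigenvalues_nonneg, fun j ↦ ?_, ?_⟩
  · have h := h₁.conjTranspose_mul_mul_same U
    have heq : Uᵀ * (1 - Y) * U = diagonal fun j ↦ 1 - h₀.1.eigenvalues j := by
      have hYU : Uᵀ * Y * U = diagonal h₀.1.eigenvalues := by
        conv_lhs => rw [hspec]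
        calc Uᵀ * (U * diagonal h₀.1.eigenvalues * Uᵀ) * U
            = (Uᵀ * U) * diagonal h₀.1.eigenvalues * (Uᵀ * U) := by simp only [Matrix.mul_assoc]
          _ = _ := by rw [hU, Matrix.one_mul, Matrix.mul_one]
      rw [Matrix.mul_sub, Matrix.sub_mul, Matrix.mul_one, hU, hYU, ← diagonal_one, diagonal_sub]
    rw [conjTranspose_eq_transpose_of_trivial, heq, posSemidef_diagonal_iff] at h
    linarith [h j]
  · rw [← htr]
    conv_rhs => rw [hspec]
    rw [trace_mul_comm, ← Matrix.mul_assoc, hU, Matrix.one_mul, trace_diagonal]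

theorem choose_card_fractional_le {n k : ℕ} (hk : 0 < k)
    {φ : Fin k → Matrix (Fin n) (Fin n) ℝ →ₗ[ℝ] ℝ} {t : ℝ} {U : Matrix (Fin n) (Fin n) ℝ}
    {μ : Fin n → ℝ} (hU : Uᵀ * U = 1) (hμ₀ : ∀ j, 0 ≤ μ j) (hμ₁ : ∀ j, μ j ≤ 1)
    (htr : ∑ j, μ j = t)
    (hmax : ∀ Z ∈ fantope n t, ⨅ i, φ i Z ≤ ⨅ i, φ i (U * diagonal μ * Uᵀ))
    (hsq : ∀ Z ∈ fantope n t, ⨅ i, φ i (U * diagonal μ * Uᵀ) ≤ ⨅ i, φ i Z →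
      ∑ i, ∑ j, Z i j ^ 2 ≤ ∑ i, ∑ j, (U * diagonal μ * Uᵀ) i j ^ 2) :
    (({j | 0 < μ j ∧ μ j < 1} : Finset (Fin n)).card + 1).choose 2 ≤ k := by
  by_contra! hlt
  have hU' : U * Uᵀ = 1 := mul_eq_one_comm.1 hU
  let C : Matrix (Fin n) (Fin n) ℝ →ₗ[ℝ] Matrix (Fin n) (Fin n) ℝ :=
    LinearMap.mulRight ℝ Uᵀ ∘ₗ LinearMap.mulLeft ℝ U
  have hC : ∀ D, C D = U * D * Uᵀ := fun _ ↦ rfl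
  let i₀ : Fin k := ⟨0, hk⟩
  obtain ⟨D, hD0, hDsymm, hDsupp, hDφ⟩ := exists_isSymm_ne_zero_of_lt_choose _ hlt fun i ↦
    if i = i₀ then traceLinearMap (Fin n) ℝ ℝ else (φ i - φ i₀) ∘ₗ C
  have hDtr : D.trace = 0 := by simpa using hDφ i₀
  have hDc : ∀ i, φ i (C D) = φ i₀ (C D) := fun i ↦ by
    by_cases hi : i = i₀
    · rw [hi]
    · simpa [hi, sub_eq_zero] using hDφ i
  have hrow : ∀ i, ¬(0 < μ i ∧ μ i < 1) → ∑ j, |D i j| = 0 := fun i hi ↦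
    Finset.sum_eq_zero fun j _ ↦ by
      by_contra hne
      exact hi (by simpa using (hDsupp i j (abs_ne_zero.1 hne)).1)
  obtain ⟨ε, hε, hεμ⟩ : ∃ ε : ℝ, 0 < ε ∧
      ∀ i, ε * ∑ j, |D i j| ≤ μ i ∧ ε * ∑ j, |D i j| ≤ 1 - μ i := by
    have hsmall : ∀ (a b : ℝ), 0 < b → ∀ᶠ ε in nhdsWithin (0 : ℝ) (Set.Ioi 0), ε * a ≤ b :=
      fun a b hb ↦ by
        have h : Filter.Tendsto (fun ε : ℝ ↦ ε * a) (nhdsWithin 0 (Set.Ioi 0)) (nhds (0 * a)) :=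
          ((continuous_id.mul continuous_const).tendsto 0).mono_left nhdsWithin_le_nhds
        rw [zero_mul] at h
        exact h.eventually_le_const hb
    have hall : ∀ᶠ ε in nhdsWithin (0 : ℝ) (Set.Ioi 0),
        ∀ i, ε * ∑ j, |D i j| ≤ μ i ∧ ε * ∑ j, |D i j| ≤ 1 - μ i := by
      refine Filter.eventually_all.2 fun i ↦ ?_
      by_cases hi : 0 < μ i ∧ μ i < 1
      · exact (hsmall _ _ hi.1).and (hsmall _ _ (sub_pos.2 hi.2))
      · simp [hrow i hi, hμ₀ i, hμ₁ i]
    obtain ⟨ε, h, hε⟩ := (hall.and self_mem_nhdsWithin).exists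
    exact ⟨ε, hε, h⟩
  have hmem : ∀ δ : ℝ, |δ| = ε → C (diagonal μ + δ • D) ∈ fantope n t := fun δ hδ ↦ by
    have hsum : ∀ η : ℝ, |η| = ε → ∀ i, ∑ j, |(η • D) i j| = ε * ∑ j, |D i j| := fun η hη i ↦ by
      simp [abs_mul, hη, Finset.mul_sum]
    refine ⟨?_, ?_, ?_⟩
    · have h := posSemidef_diagonal_add_of_sum_abs_le (hDsymm.smul δ)
        fun i ↦ (hsum δ hδ i).trans_le (hεμ i).1
      simpa only [hC, conjTranspose_eq_transpose_of_trivial] using h.mul_mul_conjTranspose_same U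
    · have h := posSemidef_diagonal_add_of_sum_abs_le (μ := fun i ↦ 1 - μ i) (hDsymm.smul (-δ))
        fun i ↦ (hsum (-δ) (by rwa [abs_neg]) i).trans_le (hεμ i).2
      have heq : (diagonal fun i ↦ 1 - μ i) + (-δ) • D = 1 - (diagonal μ + δ • D) := by
        rw [← diagonal_one, ← diagonal_sub, neg_smul]
        abel
      have h' := h.mul_mul_conjTranspose_same U
      rwa [heq, conjTranspose_eq_transpose_of_trivial, Matrix.mul_sub, Matrix.sub_mul,
        Matrix.mul_one, hU'] at h'
    · rw [hC, trace_mul_comm, ← Matrix.mul_assoc, hU, Matrix.one_mul, trace_add, trace_smul, hDtr,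
        trace_diagonal, htr, smul_zero, add_zero]
  have hadd := hmem ε (abs_of_pos hε)
  have hsub := hmem (-ε) (by rw [abs_neg, abs_of_pos hε])
  rw [map_add, map_smul] at hadd hsub
  rw [neg_smul, ← sub_eq_add_neg] at hsub
  have hzero : ε • C D = 0 := eq_zero_of_isMax_iInf hk hmax hsq hadd hsub
    (c := ε * φ i₀ (C D)) fun i ↦ by rw [map_smul, hDc, smul_eq_mul]
  refine hD0 ?_
  have hCD := (smul_eq_zero.1 hzero).resolve_left hε.ne'
  calc D = (Uᵀ * U) * D * (Uᵀ * U) := by rw [hU, Matrix.one_mul, Matrix.mul_one]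
    _ = Uᵀ * C D * U := by simp only [hC, Matrix.mul_assoc]
    _ = 0 := by rw [hCD, Matrix.mul_zero, Matrix.zero_mul]

theorem card_support_le_of_card_fractional_le {n e s : ℕ} {μ : Fin n → ℝ}
    (hμ₀ : ∀ j, 0 ≤ μ j) (hμ₁ : ∀ j, μ j ≤ 1) (hsum : ∑ j, μ j = e)
    (hs : ({j | 0 < μ j ∧ μ j < 1} : Finset (Fin n)).card ≤ s + 1) :
    ({j | μ j ≠ 0} : Finset (Fin n)).card ≤ e + s := by
  set F : Finset (Fin n) := {j | 0 < μ j ∧ μ j < 1} with hF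
  set O : Finset (Fin n) := {j | μ j = 1} with hO
  have hdisj : Disjoint O F := Finset.disjoint_left.2 fun j hj hj' ↦ by
    simp only [hO, hF, Finset.mem_filter_univ] at hj hj'
    exact hj'.2.ne hj
  have hsupp : ({j | μ j ≠ 0} : Finset (Fin n)) = O ∪ F := by
    ext j
    simp only [hO, hF, Finset.mem_union, Finset.mem_filter_univ]
    have h₀ := hμ₀ j
    have h₁ := hμ₁ j
    constructor
    · intro h
      rcases h₁.eq_or_lt with h₁ | h₁
      · exact .inl h₁
      · exact .inr ⟨h₀.lt_of_ne' h, h₁⟩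
    · rintro (h | h)
      · simp [h]
      · exact h.1.ne'
  have hcount : (O.card : ℝ) + ∑ j ∈ F, μ j = e := by
    rw [← hsum, ← Finset.sum_filter_ne_zero Finset.univ, hsupp, Finset.sum_union hdisj]
    congr 1
    rw [Finset.sum_congr rfl (g := fun _ ↦ (1 : ℝ)) fun j hj ↦ by simpa [hO] using hj]
    simp
  rw [hsupp, Finset.card_union_of_disjoint hdisj]
  rcases F.eq_empty_or_nonempty with hFe | hFne
  · rw [hFe, Finset.sum_empty, add_zero] at hcount
    have : O.card = e := by exact_mod_cast hcount
    simp [hFe, this]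
  · have hpos : 0 < ∑ j ∈ F, μ j :=
      Finset.sum_pos (fun j hj ↦ ((Finset.mem_filter_univ j).1 hj).1) hFne
    have : O.card < e := by exact_mod_cast (by linarith : (O.card : ℝ) < e)
    omega

theorem le_floor_sqrt_add_one_of_choose_le {f k : ℕ} (h : (f + 1).choose 2 ≤ k) :
    f ≤ ⌊Real.sqrt (2 * (k : ℝ) + 1 / 4) - 3 / 2⌋₊ + 1 := by
  rcases f with _ | f
  · exact Nat.zero_le _
  have hc : ((f + 1 : ℕ) : ℝ) * (f + 1 + 1) / 2 ≤ k := by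
    have h' : (((f + 1 + 1).choose 2 : ℕ) : ℝ) ≤ k := by exact_mod_cast h
    rw [Nat.cast_choose_two] at h'
    push_cast at h' ⊢
    linarith
  have hsqrt : (f : ℝ) + 3 / 2 ≤ Real.sqrt (2 * (k : ℝ) + 1 / 4) := by
    refine Real.le_sqrt_of_sq_le ?_
    push_cast at hc
    nlinarith
  exact Nat.succ_le_succ (Nat.le_floor (by linarith))

theorem Matrix.trace_mul_diagonal_mul_transpose {m n : ℕ} (B : Matrix (Fin m) (Fin n) ℝ)
    (μ : Fin n → ℝ) : (B * diagonal μ * Bᵀ).trace = ∑ j, μ j * ∑ r, B r j ^ 2 := by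
  simp only [trace, diag_apply, mul_apply (N := Bᵀ), mul_diagonal, transpose_apply, Finset.mul_sum]
  rw [Finset.sum_comm]
  exact Finset.sum_congr rfl fun j _ ↦ Finset.sum_congr rfl fun r _ ↦ by ring

theorem exists_isometry_trace_ge {n d : ℕ} {U : Matrix (Fin n) (Fin n) ℝ} {μ : Fin n → ℝ}
    (hU : Uᵀ * U = 1) (hμ₁ : ∀ j, μ j ≤ 1) (hdn : d ≤ n)
    (hcard : ({j | μ j ≠ 0} : Finset (Fin n)).card ≤ d) :
    ∃ P : Matrix (Fin n) (Fin d) ℝ, Pᵀ * P = 1 ∧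
      ∀ {m : ℕ} (A : Matrix (Fin m) (Fin n) ℝ),
        (A * (U * diagonal μ * Uᵀ) * Aᵀ).trace ≤ ((A * P)ᵀ * (A * P)).trace := by
  obtain ⟨T, hST, hT⟩ := Finset.exists_superset_card_eq hcard (by simpa using hdn)
  let e := T.orderEmbOfFin hT
  refine ⟨U.submatrix id e, ?_, fun {m} A ↦ ?_⟩
  · rw [transpose_submatrix, ← submatrix_mul _ _ _ _ _ Function.bijective_id, hU]
    exact submatrix_one _ e.injective
  have hlhs : A * (U * diagonal μ * Uᵀ) * Aᵀ = (A * U) * diagonal μ * (A * U)ᵀ := by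
    simp only [transpose_mul, Matrix.mul_assoc]
  have hAP : A * U.submatrix id e = (A * U).submatrix id e := rfl
  have himage : Finset.univ.map e.toEmbedding = T := by
    simp [e]
  have hrhs : ((A * U.submatrix id e)ᵀ * (A * U.submatrix id e)).trace =
      ∑ j ∈ T, ∑ r, (A * U) r j ^ 2 := by
    rw [hAP, ← himage, Finset.sum_map]
    simp only [trace, diag_apply, mul_apply (M := ((A * U).submatrix id e)ᵀ), transpose_apply,
      submatrix_apply, id, sq, RelEmbedding.coe_toEmbedding]
  rw [hlhs, trace_mul_diagonal_mul_transpose, hrhs,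
    ← Finset.sum_subset (Finset.subset_univ T) fun j _ hj ↦ ?_]
  · exact Finset.sum_le_sum fun j _ ↦
      mul_le_of_le_one_left (Finset.sum_nonneg fun r _ ↦ sq_nonneg _) (hμ₁ j)
  · have : μ j = 0 := by
      by_contra h
      exact hj (hST (by simpa using h))
    rw [this, zero_mul]

theorem smul_one_mem_fantope {n : ℕ} (hn : 0 < n) {t : ℝ} (ht₀ : 0 ≤ t) (htn : t ≤ n) :
    (t / n) • (1 : Matrix (Fin n) (Fin n) ℝ) ∈ fantope n t := by
  have hn' : (0 : ℝ) < n := by exact_mod_cast hn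
  have ht₁ : t / n ≤ 1 := (div_le_one hn').2 htn
  refine ⟨PosSemidef.one.smul (by positivity), ?_, ?_⟩
  · have heq : (1 : Matrix (Fin n) (Fin n) ℝ) - (t / n) • 1 = (1 - t / n) • 1 := by
      rw [sub_smul, one_smul]
    rw [heq]
    exact PosSemidef.one.smul (sub_nonneg.2 ht₁)
  · rw [trace_smul, trace_one, Fintype.card_fin, smul_eq_mul, div_mul_cancel₀ _ hn'.ne']

theorem smul_mul_transpose_mem_fantope {n d : ℕ} {Q : Matrix (Fin n) (Fin d) ℝ}
    (hQ : Qᵀ * Q = 1) {c : ℝ} (hc₀ : 0 ≤ c) (hc₁ : c ≤ 1) :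
    c • (Q * Qᵀ) ∈ fantope n (c * d) := by
  refine ⟨?_, ?_, ?_⟩
  · have h := posSemidef_self_mul_conjTranspose Q
    rw [conjTranspose_eq_transpose_of_trivial] at h
    exact h.smul hc₀
  · have hproj : (1 - Q * Qᵀ) * (1 - Q * Qᵀ)ᵀ = 1 - Q * Qᵀ := by
      have h : Q * Qᵀ * (Q * Qᵀ) = Q * Qᵀ := by
        rw [Matrix.mul_assoc, ← Matrix.mul_assoc Qᵀ, hQ, Matrix.one_mul]
      simp only [transpose_sub, transpose_one, transpose_mul, transpose_transpose, Matrix.mul_sub,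
        Matrix.sub_mul, Matrix.mul_one, Matrix.one_mul, h]
      abel
    have h := posSemidef_self_mul_conjTranspose (1 - Q * Qᵀ)
    rw [conjTranspose_eq_transpose_of_trivial, hproj] at h
    have heq : 1 - c • (Q * Qᵀ) = (1 - c) • 1 + c • (1 - Q * Qᵀ) := by
      rw [sub_smul, one_smul, smul_sub]
      abel
    rw [heq]
    exact (PosSemidef.one.smul (sub_nonneg.2 hc₁)).add (h.smul hc₀)
  · rw [trace_smul, trace_mul_comm, hQ, trace_one, Fintype.card_fin, smul_eq_mul]

/-- With `s = ⌊√(2k + 1/4) − 3/2⌋ < d`, there is a rank-`d`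
projection `P` whose min-variance objective is at least `(1 − s/d)·OPT_d`. -/
theorem stmt4 {n k d : ℕ} (hn : 0 < n) (hk : 0 < k) (hd : 0 < d) (hdn : d ≤ n)
    (m : Fin k → ℕ) (A : ∀ i : Fin k, Matrix (Fin (m i)) (Fin n) ℝ)
    (s : ℕ) (hs : s = ⌊Real.sqrt (2 * (k : ℝ) + 1 / 4) - 3 / 2⌋₊) (hsd : s < d)
    (OPT : ℝ)
    (hOPT : OPT = sSup {v : ℝ | ∃ Q : Matrix (Fin n) (Fin d) ℝ, Qᵀ * Q = 1 ∧
      v = ⨅ i : Fin k, ((A i * Q)ᵀ * (A i * Q)).trace}) :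
    ∃ P : Matrix (Fin n) (Fin d) ℝ, Pᵀ * P = 1 ∧
      (1 - (s : ℝ) / (d : ℝ)) * OPT ≤ ⨅ i : Fin k, ((A i * P)ᵀ * (A i * P)).trace := by
  have : Nonempty (Fin k) := ⟨⟨0, hk⟩⟩
  have hd' : (0 : ℝ) < d := by exact_mod_cast hd
  have hc₀ : 0 < 1 - (s : ℝ) / d := by
    rw [sub_pos, div_lt_one hd']
    exact_mod_cast hsd
  have hc₁ : 1 - (s : ℝ) / d ≤ 1 := sub_le_self _ (by positivity)
  have ht : (1 - (s : ℝ) / d) * d = ((d - s : ℕ) : ℝ) := by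
    rw [Nat.cast_sub hsd.le, sub_mul, one_mul, div_mul_cancel₀ _ hd'.ne']
  let φ : Fin k → Matrix (Fin n) (Fin n) ℝ →ₗ[ℝ] ℝ := fun i ↦
    { toFun Y := (A i * Y * (A i)ᵀ).trace
      map_add' Y Z := by rw [Matrix.mul_add, Matrix.add_mul, trace_add]
      map_smul' c Y := by simp }
  have hφ : ∀ i Y, φ i Y = (A i * Y * (A i)ᵀ).trace := fun _ _ ↦ rfl
  obtain ⟨Y, hY, hmax, hsq⟩ := exists_mem_fantope_isMax_iInf hk φ
    (t := ((d - s : ℕ) : ℝ)) ⟨_, smul_one_mem_fantope hn (Nat.cast_nonneg _)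
      (by exact_mod_cast (Nat.sub_le d s).trans hdn)⟩
  have hY₀ : 0 ≤ ⨅ i, φ i Y := Real.iInf_nonneg fun i ↦ by
    have h := (hY.1.mul_mul_conjTranspose_same (A i)).trace_nonneg
    rwa [conjTranspose_eq_transpose_of_trivial] at h
  have hOPT_le : (1 - (s : ℝ) / d) * OPT ≤ ⨅ i, φ i Y := by
    rw [mul_comm, ← le_div_iff₀ hc₀, hOPT]
    refine Real.sSup_le ?_ (by positivity)
    rintro _ ⟨Q, hQ, rfl⟩
    rw [le_div_iff₀ hc₀, mul_comm]
    refine le_trans (le_ciInf fun i ↦ ?_)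
      (hmax _ (ht ▸ smul_mul_transpose_mem_fantope hQ hc₀.le hc₁))
    have hval : φ i (Q * Qᵀ) = ((A i * Q)ᵀ * (A i * Q)).trace := by
      rw [hφ, trace_mul_comm (A i * Q)ᵀ, transpose_mul]
      simp only [Matrix.mul_assoc]
    rw [map_smul, hval, smul_eq_mul]
    exact mul_le_mul_of_nonneg_left (ciInf_le (Set.finite_range _).bddBelow i) hc₀.le
  obtain ⟨U, μ, hU, rfl, hμ₀, hμ₁, hsum⟩ := exists_diagonalization_of_mem_fantope hY
  have hfrac := le_floor_sqrt_add_one_of_choose_le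
    (choose_card_fractional_le hk hU hμ₀ hμ₁ hsum hmax hsq)
  rw [← hs] at hfrac
  have hcard := card_support_le_of_card_fractional_le hμ₀ hμ₁ hsum hfrac
  rw [Nat.sub_add_cancel hsd.le] at hcard
  obtain ⟨P, hP, hPA⟩ := exists_isometry_trace_ge hU hμ₁ hdn hcard
  exact ⟨P, hP, hOPT_le.trans (ciInf_mono (Set.finite_range _).bddBelow fun i ↦ hPA (A i))⟩
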